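/- arXiv:2202.05101 — 4 statements merged into one kernel-verified Lean document; each statement's English description precedes it below -/
import Mathlib

section
/- For every real number x, ∫_ℝ (1 + 4π²ξ²)^{-2} e^{2πi x ξ} dξ = (1/4) e^{-|x|} (|x| + 1). -/
open Real MeasureTheory

theorem integrableOn_add_one_mul_exp_neg_Ioi :
    IntegrableOn (fun t : ℝ ↦ (t + 1) * Real.exp (-t)) (Set.Ioi 0) := by
  have h1 := Real.GammaIntegral_convergent (s := 1) one_pos
  have h2 := Real.GammaIntegral_convergent (s := 2) two_pos
  refine (h2.add h1).congr_fun (fun t _ ↦ ?_) measurableSet_Ioi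
  have h : (2 : ℝ) - 1 = 1 := by norm_num
  simp only [Pi.add_apply, h, sub_self, Real.rpow_zero, Real.rpow_one]
  ring

theorem integrable_exp_neg_abs_mul_abs_add_one :
    Integrable fun t : ℝ ↦ Real.exp (-|t|) * (|t| + 1) := by
  have h : IntegrableOn (fun t : ℝ ↦ Real.exp (-|t|) * (|t| + 1)) (Set.Ioi 0) := by
    refine integrableOn_add_one_mul_exp_neg_Ioi.congr_fun (fun t ht ↦ ?_) measurableSet_Ioi
    simp only [abs_of_pos (Set.mem_Ioi.1 ht)]
    ring
  have h' : IntegrableOn (fun t : ℝ ↦ Real.exp (-|t|) * (|t| + 1)) (Set.Iic 0) := by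
    rw [integrableOn_Iic_iff_integrableOn_Iio]
    rw [← neg_zero (G := ℝ)] at h
    simpa only [abs_neg] using h.comp_neg_Iio
  rw [← integrableOn_univ, ← Set.Iic_union_Ioi (a := (0 : ℝ))]
  exact h'.union h

theorem tendsto_add_mul_cexp_neg_one_add_mul_I (w : ℝ) (b c : ℂ) :
    Filter.Tendsto (fun t : ℝ ↦ (b * t + c) * Complex.exp (-((1 + w * Complex.I) * t)))
      Filter.atTop (nhds 0) := by
  have h1 := Real.tendsto_pow_mul_exp_neg_atTop_nhds_zero 1
  have h0 := Real.tendsto_pow_mul_exp_neg_atTop_nhds_zero 0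
  have h := (h1.const_mul ‖b‖).add (h0.const_mul ‖c‖)
  simp only [mul_zero, add_zero] at h
  refine squeeze_zero_norm' ?_ h
  filter_upwards [Filter.eventually_ge_atTop 0] with t ht
  have he : ‖Complex.exp (-((1 + w * Complex.I) * t))‖ = Real.exp (-t) := by
    simp [Complex.norm_exp]
  have hb : ‖b * (t : ℂ)‖ = ‖b‖ * t := by simp [abs_of_nonneg ht]
  rw [norm_mul, he]
  calc _ ≤ (‖b * t‖ + ‖c‖) * Real.exp (-t) := by gcongr; exact norm_add_le _ _
    _ = _ := by rw [hb]; ring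

theorem integral_add_one_mul_cexp_neg_one_add_mul_I_Ioi (w : ℝ) :
    ∫ t : ℝ in Set.Ioi 0, ((t : ℂ) + 1) * Complex.exp (-((1 + w * Complex.I) * t))
      = 1 / (1 + w * Complex.I) + 1 / (1 + w * Complex.I) ^ 2 := by
  have ha : (1 + w * Complex.I : ℂ) ≠ 0 := fun h ↦ by simpa using congrArg Complex.re h
  have hlim := tendsto_add_mul_cexp_neg_one_add_mul_I w (-(1 / (1 + w * Complex.I)))
    (-(1 / (1 + w * Complex.I) + 1 / (1 + w * Complex.I) ^ 2))
  have hderiv (t : ℝ) : HasDerivAt (fun t : ℝ ↦ (-(1 / (1 + w * Complex.I)) * t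
      + -(1 / (1 + w * Complex.I) + 1 / (1 + w * Complex.I) ^ 2))
        * Complex.exp (-((1 + w * Complex.I) * t)))
      (((t : ℂ) + 1) * Complex.exp (-((1 + w * Complex.I) * t))) t := by
    have h1 := (hasDerivAt_id t).ofReal_comp
    have h2 := (h1.const_mul (1 + w * Complex.I : ℂ)).neg.cexp
    have h3 := ((h1.const_mul (-(1 / (1 + w * Complex.I : ℂ)))).add_const
      (-(1 / (1 + w * Complex.I) + 1 / (1 + w * Complex.I : ℂ) ^ 2))).mul h2
    refine h3.congr_deriv ?_
    simp only [id, Complex.ofReal_one, mul_one, Pi.neg_apply]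
    field_simp
    ring
  have hint : IntegrableOn (fun t : ℝ ↦ ((t : ℂ) + 1) * Complex.exp (-((1 + w * Complex.I) * t)))
      (Set.Ioi 0) := by
    refine integrableOn_add_one_mul_exp_neg_Ioi.mono' (by fun_prop) ?_
    filter_upwards [ae_restrict_mem measurableSet_Ioi] with t ht
    have ht' : ‖(t : ℂ) + 1‖ = t + 1 := by
      rw [← Complex.ofReal_one, ← Complex.ofReal_add, Complex.norm_real, Real.norm_eq_abs,
        abs_of_pos (add_pos ht one_pos)]
    rw [norm_mul, ht']
    simp [Complex.norm_exp]
  rw [integral_Ioi_of_hasDerivAt_of_tendsto' (fun t _ ↦ hderiv t) hint hlim]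
  simp

open FourierTransform in
theorem fourier_exp_neg_abs_mul_abs_add_one (ξ : ℝ) :
    𝓕 (fun t : ℝ ↦ (((1 / 4 : ℝ) * Real.exp (-|t|) * (|t| + 1) : ℝ) : ℂ)) ξ
      = ((((1 + 4 * π ^ 2 * ξ ^ 2) ^ 2)⁻¹ : ℝ) : ℂ) := by
  rw [Real.fourier_real_eq_integral_exp_smul]
  have hint : Integrable fun t : ℝ ↦ Complex.exp (↑(-2 * π * t * ξ) * Complex.I) •
      (((1 / 4 : ℝ) * Real.exp (-|t|) * (|t| + 1) : ℝ) : ℂ) := by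
    refine (integrable_exp_neg_abs_mul_abs_add_one.const_mul (1 / 4)).mono'
      (by fun_prop) (.of_forall fun t ↦ ?_)
    rw [norm_smul, Complex.norm_exp_ofReal_mul_I, one_mul, Complex.norm_real, Real.norm_eq_abs,
      abs_of_nonneg (by positivity), mul_assoc]
  rw [← integral_add_compl (measurableSet_Ioi (a := (0 : ℝ))) hint, Set.compl_Ioi]
  nth_rewrite 2 [← neg_zero]
  rw [← integral_comp_neg_Ioi]
  have key (w : ℝ) (f : ℝ → ℂ) (hf : ∀ t > 0, f t =
      1 / 4 * (((t : ℂ) + 1) * Complex.exp (-((1 + w * Complex.I) * t)))) :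
      ∫ t in Set.Ioi 0, f t
        = 1 / 4 * (1 / (1 + w * Complex.I) + 1 / (1 + w * Complex.I) ^ 2) := by
    rw [setIntegral_congr_fun measurableSet_Ioi hf, integral_const_mul,
      integral_add_one_mul_cexp_neg_one_add_mul_I_Ioi]
  rw [key (2 * π * ξ) _ fun t ht ↦ ?_, key (-(2 * π * ξ)) _ fun t ht ↦ ?_]
  · have h1 : (1 + (2 * π * ξ : ℝ) * Complex.I : ℂ) ≠ 0 := fun h ↦ by
      simpa using congrArg Complex.re h
    have h2 : (1 + (-(2 * π * ξ) : ℝ) * Complex.I : ℂ) ≠ 0 := fun h ↦ by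
      simpa using congrArg Complex.re h
    have h3 : (((1 + 4 * π ^ 2 * ξ ^ 2 : ℝ)) : ℂ)
        = (1 + (2 * π * ξ : ℝ) * Complex.I) * (1 + (-(2 * π * ξ) : ℝ) * Complex.I) := by
      push_cast
      linear_combination (4 * π ^ 2 * ξ ^ 2 : ℂ) * Complex.I_sq
    have h4 : (1 + (2 * π * ξ : ℝ) * Complex.I : ℂ) + (1 + (-(2 * π * ξ) : ℝ) * Complex.I) = 2 := by
      push_cast
      ring
    rw [Complex.ofReal_inv, Complex.ofReal_pow, h3]
    generalize (1 + (2 * π * ξ : ℝ) * Complex.I : ℂ) = a at h1 h4 ⊢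
    generalize (1 + (-(2 * π * ξ) : ℝ) * Complex.I : ℂ) = b at h2 h4 ⊢
    field_simp
    linear_combination (a * b + a + b + 2) * h4
  · rw [abs_neg, abs_of_pos ht, smul_eq_mul]
    push_cast
    rw [show (-((1 + -(2 * π * ξ) * Complex.I) * t) : ℂ) = -2 * π * -t * ξ * Complex.I + -t by ring,
      Complex.exp_add]
    ring
  · rw [abs_of_pos ht, smul_eq_mul]
    push_cast
    rw [show (-((1 + 2 * π * ξ * Complex.I) * t) : ℂ) = -2 * π * t * ξ * Complex.I + -t by ring,
      Complex.exp_add]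
    ring

theorem integrable_inv_one_add_four_pi_sq_mul_sq_sq :
    Integrable fun ξ : ℝ ↦ ((1 + 4 * π ^ 2 * ξ ^ 2) ^ 2)⁻¹ := by
  have h := integrable_inv_one_add_sq.comp_mul_left' (R := 2 * π) (by positivity)
  refine h.mono' (by fun_prop) (.of_forall fun ξ ↦ ?_)
  rw [Real.norm_eq_abs, abs_of_nonneg (by positivity)]
  have h1 : 1 + (2 * π * ξ) ^ 2 = 1 + 4 * π ^ 2 * ξ ^ 2 := by ring
  rw [h1]
  have h2 : 1 ≤ 1 + 4 * π ^ 2 * ξ ^ 2 := le_add_of_nonneg_right (by positivity)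
  gcongr
  exact le_self_pow₀ h2 two_ne_zero

/-- The Bessel kernel `G₄` in dimension one: the inverse Fourier transform of
`ξ ↦ (1+4π²ξ²)⁻²` is `x ↦ (1/4) e^{-|x|}(|x|+1)`. -/
theorem bessel_kernel_G4 (x : ℝ) :
    ∫ ξ : ℝ, ((((1 + 4 * π ^ 2 * ξ ^ 2) ^ 2)⁻¹ : ℝ) : ℂ) * Complex.exp (2 * π * Complex.I * x * ξ)
      = ((1 / 4 : ℝ) * Real.exp (-|x|) * (|x| + 1) : ℝ) := by
  have hF := funext fourier_exp_neg_abs_mul_abs_add_one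
  have hint : Integrable fun t : ℝ ↦ (((1 / 4 : ℝ) * Real.exp (-|t|) * (|t| + 1) : ℝ) : ℂ) := by
    simp only [mul_assoc]
    exact (integrable_exp_neg_abs_mul_abs_add_one.const_mul (1 / 4)).ofReal
  have hinv := congrFun (Continuous.fourierInv_fourier_eq (by fun_prop) hint
    (hF ▸ integrable_inv_one_add_four_pi_sq_mul_sq_sq.ofReal)) x
  rw [hF, Real.fourierInv_eq'] at hinv
  rw [← hinv]
  congr 1 with ξ
  rw [smul_eq_mul, mul_comm]
  congr 2
  simp
  ring
end

section
/- Let s ≥ 0 be a real number and let u, v ∈ L² of the circle ℝ/ℤ (with its normalized Haar probability measure), with Fourier coefficients û_k = ⟨u, e_k⟩ and v̂_k = ⟨v, e_k⟩ where e_k(x) = e^{2πi k x}. Assume the family ((1+4π²k²)^s |v̂_k|²)_{k∈ℤ} is summable. Then there exists z ∈ L²(ℝ/ℤ) whose Fourier coefficients satisfy ẑ_k = (1+4π²k²)^{-s} û_k for all k ∈ ℤ, and for any such z the family ((1+4π²k²)^s ẑ_k · conj(v̂_k))_{k∈ℤ} is summable with Σ_{k∈ℤ} (1+4π²k²)^s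 ẑ_k · conj(v̂_k) = ⟨u, v⟩_{L²}. -/
open MeasureTheory Real AddCircle
open scoped InnerProductSpace

/-- Parseval's identity for the inner product of `L²` functions on the circle. -/
theorem hasSum_fourierCoeff_mul_conj {T : ℝ} [Fact (0 < T)]
    (u v : Lp ℂ 2 (@haarAddCircle T _)) :
    HasSum (fun k : ℤ => fourierCoeff (⇑u) k * (starRingEnd ℂ) (fourierCoeff (⇑v) k))
      ⟪v, u⟫_ℂ := by
  rw [← (fourierBasis (T := T)).repr.inner_map_map v u]
  simp only [← fourierBasis_repr]
  exact lp.hasSum_inner (fourierBasis.repr v) (fourierBasis.repr u)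

/-- A bounded sequence is an `L²` Fourier multiplier on the circle. -/
theorem exists_fourierCoeff_eq_mul {T : ℝ} [Fact (0 < T)] (m : ℤ → ℂ) {C : ℝ}
    (hm : ∀ k, ‖m k‖ ≤ C) (u : Lp ℂ 2 (@haarAddCircle T _)) :
    ∃ z : Lp ℂ 2 (@haarAddCircle T _),
      ∀ k : ℤ, fourierCoeff (⇑z) k = m k * fourierCoeff (⇑u) k := by
  have hmem : Memℓp (fun k : ℤ => m k * fourierCoeff (⇑u) k) 2 := by
    refine memℓp_gen ?_
    simp only [ENNReal.toReal_ofNat, Real.rpow_two]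
    refine Summable.of_nonneg_of_le (fun k => by positivity) (fun k => ?_)
      ((hasSum_sq_fourierCoeff u).summable.mul_left (C ^ 2))
    rw [norm_mul, mul_pow]
    gcongr
    exact hm k
  refine ⟨fourierBasis.repr.symm ⟨_, hmem⟩, fun k => ?_⟩
  rw [← fourierBasis_repr, LinearIsometryEquiv.apply_symm_apply]

/-- Fourier-series characterization of the adjoint embedding `E_s^* : L²(𝕋) → H^s(𝕋)` on the
circle `ℝ/ℤ`: there is `z ∈ L²` with Fourier coefficients `ẑ_k = (1+4π²k²)^{-s} û_k`, and any
such `z` satisfies `Σ_k (1+4π²k²)^s ẑ_k conj(v̂_k) = ⟨u,v⟩_{L²}` (the paper's inner product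
`⟨u,v⟩`, linear in the first argument, is Mathlib's `⟪v,u⟫_ℂ`). -/
theorem adjoint_embedding_fourier_series (s : ℝ) (hs : 0 ≤ s)
    (u v : Lp ℂ 2 (@haarAddCircle 1 _))
    (hv : Summable fun k : ℤ =>
      (1 + 4 * π ^ 2 * (k : ℝ) ^ 2) ^ s * ‖fourierCoeff (⇑v) k‖ ^ 2) :
    (∃ z : Lp ℂ 2 (@haarAddCircle 1 _),
      ∀ k : ℤ, fourierCoeff (⇑z) k
        = (((1 + 4 * π ^ 2 * (k : ℝ) ^ 2) ^ (-s) : ℝ) : ℂ) * fourierCoeff (⇑u) k) ∧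
    ∀ z : Lp ℂ 2 (@haarAddCircle 1 _),
      (∀ k : ℤ, fourierCoeff (⇑z) k
        = (((1 + 4 * π ^ 2 * (k : ℝ) ^ 2) ^ (-s) : ℝ) : ℂ) * fourierCoeff (⇑u) k) →
      Summable (fun k : ℤ => (((1 + 4 * π ^ 2 * (k : ℝ) ^ 2) ^ s : ℝ) : ℂ) *
          fourierCoeff (⇑z) k * (starRingEnd ℂ) (fourierCoeff (⇑v) k)) ∧
      ∑' k : ℤ, (((1 + 4 * π ^ 2 * (k : ℝ) ^ 2) ^ s : ℝ) : ℂ) *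
          fourierCoeff (⇑z) k * (starRingEnd ℂ) (fourierCoeff (⇑v) k)
        = ⟪v, u⟫_ℂ := by
  have hpos (k : ℤ) : 0 < 1 + 4 * π ^ 2 * (k : ℝ) ^ 2 := by positivity
  refine ⟨exists_fourierCoeff_eq_mul _ (C := 1) (fun k => ?_) u, fun z hz => ?_⟩
  · rw [Complex.norm_real, Real.norm_of_nonneg (Real.rpow_nonneg (hpos k).le _)]
    refine Real.rpow_le_one_of_one_le_of_nonpos ?_ (neg_nonpos.mpr hs)
    exact le_add_of_nonneg_right (by positivity)
  · have hcancel (k : ℤ) : (((1 + 4 * π ^ 2 * (k : ℝ) ^ 2) ^ s : ℝ) : ℂ) *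
        fourierCoeff (⇑z) k = fourierCoeff (⇑u) k := by
      rw [hz, ← mul_assoc, ← Complex.ofReal_mul, ← Real.rpow_add (hpos k), add_neg_cancel,
        Real.rpow_zero, Complex.ofReal_one, one_mul]
    simp only [hcancel]
    have hsum := hasSum_fourierCoeff_mul_conj u v
    exact ⟨hsum.summable, hsum.tsum_eq⟩
end

section
/- Let H₁ and H₂ be real Hilbert spaces, E : H₁ → H₂ a bounded linear operator with adjoint E^* : H₂ → H₁, and let φ : Fin m → H₁ and ψ : Fin n → H₂ be linearly independent families. Let P be the orthogonal projection of H₁ onto span{φ_1,…,φ_m} and Q the orthogonal projection of H₂ onto span{ψ_1,…,ψ_n}. Define the matrices H_X ∈ ℝ^{m×m} with (H_X)_{k,j} = ⟨φ_j, φ_k⟩_{H₁}, H_Y ∈ ℝ^{n×n} with (H_Y)_{k,j} = ⟨ψ_j, ψ_k⟩_{H₂}, and M ∈ ℝ^{m×n} with M_{k,j} = ⟨ψ_j, E φ_k⟩_{H₂}; the Gram matrices H_X and H_Y are invertible. Then for every u ∈ H₂, with 𝐮 = (⟨u, ψ_j⟩_{H₂})_{j=1}^n and z := H_X^{-1} M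 H_Y^{-1} 𝐮 ∈ ℝ^m, one has P(E^*(Q u)) = Σ_{k=1}^m z_k φ_k. -/
open scoped RealInnerProductSpace

/-- The orthogonal projection onto the span of a finite family, in coordinates: the coefficient
vector is obtained by applying the inverse Gram matrix to the moments. -/
theorem eq_sum_inv_gram_mulVec_smul {H ι : Type*} [NormedAddCommGroup H] [InnerProductSpace ℝ H]
    [Fintype ι] [DecidableEq ι] {v : ι → H} {G : Matrix ι ι ℝ} (hG : ∀ k j, G k j = ⟪v j, v k⟫)
    (hGu : IsUnit G) {x p : H} (hp : p ∈ Submodule.span ℝ (Set.range v))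
    (hxp : x - p ∈ (Submodule.span ℝ (Set.range v))ᗮ) :
    p = ∑ k, (G⁻¹.mulVec fun j => ⟪x, v j⟫) k • v k := by
  obtain ⟨c, rfl⟩ := (Submodule.mem_span_range_iff_exists_fun ℝ).1 hp
  have moments : (fun k => ⟪x, v k⟫) = G.mulVec c := by
    ext k
    have h := (Submodule.mem_orthogonal' _ _).1 hxp (v k) (Submodule.subset_span ⟨k, rfl⟩)
    rw [inner_sub_left, sub_eq_zero] at h
    simp [h, sum_inner, real_inner_smul_left, Matrix.mulVec, dotProduct, hG, mul_comm]
  rw [moments, Matrix.mulVec_mulVec,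
    Matrix.nonsing_inv_mul _ ((Matrix.isUnit_iff_isUnit_det G).1 hGu), Matrix.one_mulVec]

/-- Galerkin (finite-dimensional) representation of the adjoint of a bounded operator
`E : H₁ → H₂` between real Hilbert spaces through the Gram matrices of bases
`φ` of `X_m ⊂ H₁` and `ψ` of `Y_n ⊂ H₂`: with `P`, `Q` the orthogonal projections onto
the spans, `P E^* Q u = Σ_k z_k φ_k` where `z = H_X⁻¹ M H_Y⁻¹ 𝐮`. -/
theorem adjoint_embedding_discrete {H₁ H₂ : Type*}
    [NormedAddCommGroup H₁] [InnerProductSpace ℝ H₁] [CompleteSpace H₁]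
    [NormedAddCommGroup H₂] [InnerProductSpace ℝ H₂] [CompleteSpace H₂]
    (E : H₁ →L[ℝ] H₂) {m n : ℕ}
    (φ : Fin m → H₁) (ψ : Fin n → H₂)
    (hφ : LinearIndependent ℝ φ) (hψ : LinearIndependent ℝ ψ)
    (P : H₁ →L[ℝ] H₁)
    (hP : ∀ x : H₁, P x ∈ Submodule.span ℝ (Set.range φ) ∧
      x - P x ∈ (Submodule.span ℝ (Set.range φ))ᗮ)
    (Q : H₂ →L[ℝ] H₂)
    (hQ : ∀ y : H₂, Q y ∈ Submodule.span ℝ (Set.range ψ) ∧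
      y - Q y ∈ (Submodule.span ℝ (Set.range ψ))ᗮ)
    (HX : Matrix (Fin m) (Fin m) ℝ) (hHX : ∀ k j, HX k j = ⟪φ j, φ k⟫)
    (HY : Matrix (Fin n) (Fin n) ℝ) (hHY : ∀ k j, HY k j = ⟪ψ j, ψ k⟫)
    (M : Matrix (Fin m) (Fin n) ℝ) (hM : ∀ k j, M k j = ⟪ψ j, E (φ k)⟫)
    (hHXinv : IsUnit HX) (hHYinv : IsUnit HY) :
    ∀ u : H₂,
      P ((ContinuousLinearMap.adjoint E) (Q u))
        = ∑ k : Fin m, ((HX⁻¹ * M * HY⁻¹).mulVec (fun j : Fin n => ⟪u, ψ j⟫)) k • φ k := by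
  intro u
  have moments : (fun k => ⟪ContinuousLinearMap.adjoint E (Q u), φ k⟫) =
      M.mulVec (HY⁻¹.mulVec fun j => ⟪u, ψ j⟫) := by
    ext k
    rw [ContinuousLinearMap.adjoint_inner_left,
      eq_sum_inv_gram_mulVec_smul hHY hHYinv (hQ u).1 (hQ u).2, sum_inner]
    simp only [real_inner_smul_left, ← hM, Matrix.mulVec.eq_1 M, dotProduct, mul_comm]
  rw [eq_sum_inv_gram_mulVec_smul hHX hHXinv (hP _).1 (hP _).2, moments,
    Matrix.mulVec_mulVec, Matrix.mulVec_mulVec, Matrix.mul_assoc]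
end

section
/- Let m ∈ ℕ with m ≥ 1, let a < b be real numbers, let u : ℝ → ℝ be continuous, and let z : ℝ → ℝ be of class C^{2m} with z^{(k)}(a) = 0 and z^{(k)}(b) = 0 for all k with m ≤ k ≤ 2m−1, and (−1)^m z^{(2m)}(x) + z(x) = u(x) for all x ∈ [a,b]. Then for every function v : ℝ → ℝ of class C^m, ∫_a^b ( z^{(m)}(x) v^{(m)}(x) + z(x) v(x) ) dx = ∫_a^b u(x) v(x) dx. -/
open MeasureTheory intervalIntegral

/-- The derivative of the `n`-th iterated derivative of a function of class `C^k`, `n < k`. -/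
theorem ContDiff.hasDerivAt_iteratedDeriv {k n : ℕ} {f : ℝ → ℝ} (hf : ContDiff ℝ k f)
    (hn : n < k) (x : ℝ) :
    HasDerivAt (iteratedDeriv n f) (iteratedDeriv (n + 1) f x) x := by
  rw [iteratedDeriv_succ]
  exact (hf.differentiable_iteratedDeriv n (by exact_mod_cast hn) x).hasDerivAt

/-- Iterated integration by parts when the boundary terms of one factor vanish. -/
theorem integral_iteratedDeriv_mul_iteratedDeriv {a b : ℝ} {f g : ℝ → ℝ} {j k : ℕ}
    (hf : ContDiff ℝ (k + j : ℕ) f) (hg : ContDiff ℝ j g)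
    (ha : ∀ i, k ≤ i → i < k + j → iteratedDeriv i f a = 0)
    (hb : ∀ i, k ≤ i → i < k + j → iteratedDeriv i f b = 0) :
    ∫ x in a..b, iteratedDeriv k f x * iteratedDeriv j g x
      = (-1) ^ j * ∫ x in a..b, iteratedDeriv (k + j) f x * g x := by
  induction j generalizing k with
  | zero => simp
  | succ j ih =>
    have parts := integral_mul_deriv_eq_deriv_mul (a := a) (b := b)
      (fun x _ ↦ hf.hasDerivAt_iteratedDeriv (n := k) (by omega) x)
      (fun x _ ↦ hg.hasDerivAt_iteratedDeriv (n := j) (by omega) x)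
      ((hf.continuous_iteratedDeriv (k + 1)
        (by exact_mod_cast (by omega : k + 1 ≤ k + (j + 1)))).intervalIntegrable a b)
      ((hg.continuous_iteratedDeriv' (j + 1)).intervalIntegrable a b)
    have shift : k + (j + 1) = k + 1 + j := by omega
    rw [parts, ha k le_rfl (by omega), hb k le_rfl (by omega)]
    rw [shift] at hf ha hb ⊢
    rw [ih hf (hg.of_le (by exact_mod_cast j.le_succ))
      (fun i hi ↦ ha i (by omega)) (fun i hi ↦ hb i (by omega))]
    ring

/-- BVP characterization of the adjoint embedding `E_m^*` on an interval for the equivalent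
norm `(‖z‖²_{L²} + ‖z^{(m)}‖²_{L²})^{1/2}`: a classical solution `z` of
`(−1)^m z^{(2m)} + z = u` with `z^{(k)}(a) = z^{(k)}(b) = 0` for `m ≤ k ≤ 2m−1` satisfies
`∫_a^b (z^{(m)} v^{(m)} + z v) = ∫_a^b u v` for all `C^m` test functions `v`. -/
theorem adjoint_embedding_Em_bvp (m : ℕ) (hm : 1 ≤ m) (a b : ℝ) (hab : a < b)
    (u : ℝ → ℝ) (hu : Continuous u)
    (z : ℝ → ℝ) (hz : ContDiff ℝ (2 * m : ℕ) z)
    (hbda : ∀ k, m ≤ k → k ≤ 2 * m - 1 → iteratedDeriv k z a = 0)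
    (hbdb : ∀ k, m ≤ k → k ≤ 2 * m - 1 → iteratedDeriv k z b = 0)
    (hbvp : ∀ x ∈ Set.Icc a b, (-1 : ℝ) ^ m * iteratedDeriv (2 * m) z x + z x = u x) :
    ∀ v : ℝ → ℝ, ContDiff ℝ (m : ℕ) v →
      ∫ x in a..b, (iteratedDeriv m z x * iteratedDeriv m v x + z x * v x)
        = ∫ x in a..b, u x * v x := by
  intro v hv
  have hz_cont (k : ℕ) (hk : k ≤ 2 * m) : Continuous (iteratedDeriv k z) :=
    hz.continuous_iteratedDeriv k (by exact_mod_cast hk)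
  have hv_cont : Continuous v := hv.continuous
  have parts := integral_iteratedDeriv_mul_iteratedDeriv (a := a) (b := b) (k := m)
    (by rwa [← two_mul]) hv
    (fun k hk hk' ↦ hbda k hk (by omega)) (fun k hk hk' ↦ hbdb k hk (by omega))
  rw [← two_mul] at parts
  have hzv : IntervalIntegrable (fun x ↦ z x * v x) volume a b :=
    (hz.continuous.mul hv_cont).intervalIntegrable a b
  have hmm : IntervalIntegrable (fun x ↦ iteratedDeriv m z x * iteratedDeriv m v x) volume a b :=
    ((hz_cont m (by omega)).mul (hv.continuous_iteratedDeriv' m)).intervalIntegrable a b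
  have htop : IntervalIntegrable
      (fun x ↦ (-1 : ℝ) ^ m * (iteratedDeriv (2 * m) z x * v x)) volume a b :=
    (((hz_cont _ le_rfl).mul hv_cont).const_mul _).intervalIntegrable a b
  rw [intervalIntegral.integral_add hmm hzv, parts, ← intervalIntegral.integral_const_mul,
    ← intervalIntegral.integral_add htop hzv]
  refine integral_congr fun x hx ↦ ?_
  rw [Set.uIcc_of_le hab.le] at hx
  simp only [← hbvp x hx]
  ring
end
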